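/- Fix an integer d ≥ 2. There exists a constant C > 0 depending only on d such that for every prime p, the number of tuples Q ∈ (ℤ/p²ℤ)^{2d+2} with 𝔯(Q) = 0 in ℤ/p²ℤ is at most C·p^{4d+2}. -/

import Mathlib

open Filter MvPolynomial

noncomputable section

/-- The `2d × 2d` Sylvester matrix of the two generic binary forms of degree `d`,
with entries taken from the coordinates of `Q` (the first `d+1` coordinates of `Q`
are the coefficients of `F`, the last `d+1` ones those of `G`). -/
def sylvesterMat (d : ℕ) {R : Type*} [CommRing R] (Q : Fin (2 * d + 2) → R) :
    Matrix (Fin (2 * d)) (Fin (2 * d)) R :=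
  Matrix.of fun i j =>
    if hi : (i : ℕ) < d then
      if h : (i : ℕ) ≤ (j : ℕ) ∧ (j : ℕ) ≤ (i : ℕ) + d then
        Q ⟨(j : ℕ) - (i : ℕ), by omega⟩
      else 0
    else
      if h : (i : ℕ) - d ≤ (j : ℕ) ∧ (j : ℕ) ≤ (i : ℕ) then
        Q ⟨d + 1 + ((j : ℕ) - ((i : ℕ) - d)), by omega⟩
      else 0

/-- The generic resultant polynomial `𝔯 ∈ ℤ[x₀,…,x_d,y₀,…,y_d]`:
the determinant of the Sylvester matrix of the generic binary forms of degree `d`. -/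
def resPoly (d : ℕ) : MvPolynomial (Fin (2 * d + 2)) ℤ :=
  Matrix.det (sylvesterMat d fun i => X i)

/-- Evaluation `𝔯(Q)` of the generic resultant at a tuple `Q` with entries in a
commutative ring (i.e. evaluation of the image of `𝔯` under the coefficient map `ℤ → R`). -/
def resEval (d : ℕ) {R : Type*} [CommRing R] (Q : Fin (2 * d + 2) → R) : R :=
  aeval Q (resPoly d)

/-- The set `𝒫 ⊆ ℤ^{2d+2}` identified with `ℙ^{2d+1}(ℚ)`: integer tuples with gcd `1`
whose first nonzero coordinate is positive. -/
def projPts (d : ℕ) : Set (Fin (2 * d + 2) → ℤ) :=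
  {C | Finset.univ.gcd C = 1 ∧ ∃ i, 0 < C i ∧ ∀ j, j < i → C j = 0}

/-- The box of integer tuples with `|xᵢ| ≤ rᵢ` for all `i`. -/
def box {m : ℕ} (r : Fin m → ℝ) : Set (Fin m → ℤ) :=
  {x | ∀ i, |(x i : ℝ)| ≤ r i}

/-- The value `ζ(k)` of the Riemann zeta function at an integer `k` (for `k ≥ 2`). -/
def zetaVal (k : ℕ) : ℝ := ∑' n : ℕ+, (1 : ℝ) / ((n : ℕ) : ℝ) ^ k

/-- The local factor `π_p^{(k)}`. -/
def piLocal (d p k : ℕ) : ℝ :=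
  (Nat.card {Q : Fin (2 * d + 2) → ZMod (p ^ k) // resEval d Q ≠ 0} : ℝ) /
    ((p : ℝ) ^ ((2 * d + 2) * k) * (1 - 1 / (p : ℝ) ^ (2 * d + 2)))


/-- The polynomial `∑ x_j T^j` attached to the first `d + 1` coordinates of `Q`. -/
def leftForm (d : ℕ) {R : Type*} [CommRing R] (Q : Fin (2 * d + 2) → R) : Polynomial R :=
  ∑ j : Fin (d + 1), Polynomial.monomial (j : ℕ) (Q ⟨j, by omega⟩)

/-- The polynomial `∑ y_j T^j` attached to the last `d + 1` coordinates of `Q`. -/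
def rightForm (d : ℕ) {R : Type*} [CommRing R] (Q : Fin (2 * d + 2) → R) : Polynomial R :=
  ∑ j : Fin (d + 1), Polynomial.monomial (j : ℕ) (Q ⟨d + 1 + j, by omega⟩)

/-- The index of the coordinate `y_0`. -/
def constIdx (d : ℕ) : Fin (2 * d + 2) := ⟨d + 1, by omega⟩

/-- The index of the coordinate `x_d`. -/
def leadIdx (d : ℕ) : Fin (2 * d + 2) := ⟨d, by omega⟩

section Forms

variable (d : ℕ) {R S : Type*} [CommRing R] [CommRing S] (Q : Fin (2 * d + 2) → R)

lemma leftForm_coeff (m : ℕ) :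
    (leftForm d Q).coeff m = if h : m ≤ d then Q ⟨m, by omega⟩ else 0 := by
  simp only [leftForm, Polynomial.finsetSum_coeff, Polynomial.coeff_monomial]
  split_ifs with h
  · rw [Finset.sum_eq_single ⟨m, by omega⟩]
    · simp
    · intro b _ hb
      rw [if_neg]
      rintro rfl
      exact hb rfl
    · simp
  · exact Finset.sum_eq_zero fun j _ => if_neg (by omega)

lemma rightForm_coeff (m : ℕ) :
    (rightForm d Q).coeff m = if h : m ≤ d then Q ⟨d + 1 + m, by omega⟩ else 0 := by
  simp only [rightForm, Polynomial.finsetSum_coeff, Polynomial.coeff_monomial]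
  split_ifs with h
  · rw [Finset.sum_eq_single ⟨m, by omega⟩]
    · simp
    · intro b _ hb
      rw [if_neg]
      rintro rfl
      exact hb rfl
    · simp
  · exact Finset.sum_eq_zero fun j _ => if_neg (by omega)

lemma natDegree_leftForm_le : (leftForm d Q).natDegree ≤ d := by
  rw [Polynomial.natDegree_le_iff_coeff_eq_zero]
  intro m hm
  rw [leftForm_coeff, dif_neg (by omega)]

lemma natDegree_rightForm_le : (rightForm d Q).natDegree ≤ d := by
  rw [Polynomial.natDegree_le_iff_coeff_eq_zero]
  intro m hm
  rw [rightForm_coeff, dif_neg (by omega)]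

lemma map_resEval (φ : R →+* S) : φ (resEval d Q) = resEval d fun i => φ (Q i) :=
  MvPolynomial.comp_aeval_apply (f := Q) φ.toIntAlgHom (resPoly d)

lemma resEval_eq_det : resEval d Q = (sylvesterMat d Q).det := by
  unfold resEval resPoly
  rw [AlgHom.map_det]
  congr 1
  ext i j
  simp only [sylvesterMat, AlgHom.mapMatrix_apply, Matrix.map_apply, Matrix.of_apply]
  split_ifs <;> simp

lemma resEval_eq_resultant :
    resEval d Q = (rightForm d Q).resultant (leftForm d Q) d d := by
  rw [resEval_eq_det, Polynomial.resultant, ← Matrix.det_transpose,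
    ← Matrix.det_reindex_self (finCongr (two_mul d))]
  congr 1
  ext i j
  simp only [Matrix.reindex_apply, Matrix.submatrix_apply, Matrix.transpose_apply, sylvesterMat,
    Matrix.of_apply, Polynomial.sylvester]
  induction j using Fin.addCases with
  | left j =>
    have hj := j.isLt
    simp only [Fin.addCases_left, finCongr_symm, finCongr_apply, Fin.val_cast, Fin.val_castAdd,
      dif_pos hj, Set.mem_Icc, leftForm_coeff]
    split_ifs with h h2
    · rfl
    · omega
    · rfl
  | right j =>
    have hj := j.isLt
    have h0 : ¬ (d + (j : ℕ) < d) := by omega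
    simp only [Fin.addCases_right, finCongr_symm, finCongr_apply, Fin.val_cast, Fin.val_natAdd,
      dif_neg h0, Set.mem_Icc, rightForm_coeff]
    split_ifs with h h1 h2 h3 <;> first | omega | skip
    · congr 2; omega
    · rfl

/-- The point `Q` with the indeterminate added to the coordinate `y_0`. -/
def shiftedPoint : Fin (2 * d + 2) → Polynomial R :=
  fun i => Polynomial.C (Q i) + if i = constIdx d then Polynomial.X else 0

lemma leftForm_shiftedPoint :
    leftForm d (shiftedPoint d Q) = (leftForm d Q).map Polynomial.C := by
  ext1 m
  rw [Polynomial.coeff_map, leftForm_coeff, leftForm_coeff]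
  split_ifs with h
  · have : (⟨m, by omega⟩ : Fin (2 * d + 2)) ≠ constIdx d := by
      simp only [constIdx, ne_eq, Fin.mk.injEq]; omega
    simp [shiftedPoint, this]
  · simp

lemma rightForm_shiftedPoint :
    rightForm d (shiftedPoint d Q) =
      (rightForm d Q).map Polynomial.C + Polynomial.C Polynomial.X := by
  ext1 m
  rw [Polynomial.coeff_add, Polynomial.coeff_map, rightForm_coeff, rightForm_coeff,
    Polynomial.coeff_C]
  split_ifs with h h1
  · subst h1
    simp [shiftedPoint, constIdx]
  · have : (⟨d + 1 + m, by omega⟩ : Fin (2 * d + 2)) ≠ constIdx d := by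
      simp only [constIdx, ne_eq, Fin.mk.injEq]; omega
    simp [shiftedPoint, this]
  · omega
  · simp

/-- The resultant along the line through `Q` in the direction of `y_0`. -/
def linePoly : Polynomial R := resEval d (shiftedPoint d Q)

lemma linePoly_map (φ : R →+* S) :
    (linePoly d Q).map φ = linePoly d fun i => φ (Q i) := by
  rw [← Polynomial.coe_mapRingHom, linePoly, map_resEval]
  congr 1
  funext i
  simp only [shiftedPoint, map_add, Polynomial.coe_mapRingHom, Polynomial.map_C]
  split_ifs <;> simp

lemma linePoly_eval (t : R) :
    (linePoly d Q).eval t = resEval d fun i => Q i + if i = constIdx d then t else 0 := by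
  rw [← Polynomial.coe_evalRingHom, linePoly, map_resEval]
  congr 1
  funext i
  simp only [shiftedPoint, map_add, Polynomial.coe_evalRingHom, Polynomial.eval_C]
  split_ifs <;> simp

variable {d} in
lemma linePoly_eq_prod [IsDomain R] (hQ : Q (leadIdx d) ≠ 0) (hs : (leftForm d Q).Splits) :
    linePoly d Q = Polynomial.C ((-1) ^ (d * d) * Q (leadIdx d) ^ d) *
      ((leftForm d Q).roots.map fun a =>
        Polynomial.X + Polynomial.C ((rightForm d Q).eval a)).prod := by
  have hc : (leftForm d Q).coeff d = Q (leadIdx d) := by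
    rw [leftForm_coeff, dif_pos le_rfl]; rfl
  have hd : (leftForm d Q).natDegree = d :=
    le_antisymm (natDegree_leftForm_le d Q)
      (Polynomial.le_natDegree_of_ne_zero (by rwa [hc]))
  have hd' : ((leftForm d Q).map (Polynomial.C (R := R))).natDegree = d := by
    rw [Polynomial.natDegree_map_eq_of_injective Polynomial.C_injective, hd]
  rw [linePoly, resEval_eq_resultant, Polynomial.resultant_comm]
  have h := Polynomial.resultant_eq_prod_eval (leftForm d (shiftedPoint d Q))
    (rightForm d (shiftedPoint d Q)) d (natDegree_rightForm_le d _)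
    (by rw [leftForm_shiftedPoint]; exact hs.map _)
  rw [leftForm_shiftedPoint, rightForm_shiftedPoint, hd'] at h
  rw [leftForm_shiftedPoint, rightForm_shiftedPoint, h,
    Polynomial.leadingCoeff_map_of_injective Polynomial.C_injective, Polynomial.leadingCoeff, hd, hc,
    hs.roots_map_of_injective Polynomial.C_injective, Multiset.map_map]
  simp [mul_assoc, add_comm, Polynomial.eval_map, Polynomial.eval₂_at_apply]

variable {d} in
lemma natDegree_linePoly_of_splits [IsDomain R] (hQ : Q (leadIdx d) ≠ 0)
    (hs : (leftForm d Q).Splits) : (linePoly d Q).natDegree = d := by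
  have hc : (leftForm d Q).coeff d = Q (leadIdx d) := by
    rw [leftForm_coeff, dif_pos le_rfl]; rfl
  have hd : (leftForm d Q).natDegree = d :=
    le_antisymm (natDegree_leftForm_le d Q)
      (Polynomial.le_natDegree_of_ne_zero (by rwa [hc]))
  rw [linePoly_eq_prod Q hQ hs, Polynomial.natDegree_C_mul (by simp [hQ]),
    Polynomial.natDegree_multiset_prod_of_monic]
  · simp [Multiset.map_map, ← hs.natDegree_eq_card_roots, hd]
  · simp only [Multiset.mem_map]
    rintro _ ⟨a, -, rfl⟩
    exact Polynomial.monic_X_add_C _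

end Forms

lemma natDegree_linePoly (d : ℕ) {R : Type*} [CommRing R] [IsDomain R] (Q : Fin (2 * d + 2) → R)
    (hQ : Q (leadIdx d) ≠ 0) : (linePoly d Q).natDegree = d := by
  let L := AlgebraicClosure (FractionRing R)
  have hinj : Function.Injective (algebraMap R L) := by
    rw [IsScalarTower.algebraMap_eq R (FractionRing R) L]
    exact (algebraMap (FractionRing R) L).injective.comp (IsFractionRing.injective R _)
  rw [← Polynomial.natDegree_map_eq_of_injective hinj, linePoly_map]
  exact natDegree_linePoly_of_splits _
    (by rwa [Ne, map_eq_zero_iff _ hinj]) (IsAlgClosed.splits _)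

lemma linePoly_ne_zero (d : ℕ) {R : Type*} [CommRing R] [IsDomain R] (Q : Fin (2 * d + 2) → R)
    (hQ : Q (leadIdx d) ≠ 0) : linePoly d Q ≠ 0 := by
  let L := AlgebraicClosure (FractionRing R)
  have hinj : Function.Injective (algebraMap R L) := by
    rw [IsScalarTower.algebraMap_eq R (FractionRing R) L]
    exact (algebraMap (FractionRing R) L).injective.comp (IsFractionRing.injective R _)
  intro h
  have h1 := linePoly_map d Q (algebraMap R L)
  have hQ' : algebraMap R L (Q (leadIdx d)) ≠ 0 := by rwa [Ne, map_eq_zero_iff _ hinj]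
  rw [h, Polynomial.map_zero, linePoly_eq_prod _ hQ' (IsAlgClosed.splits _), eq_comm,
    mul_eq_zero, Multiset.prod_eq_zero_iff] at h1
  rcases h1 with h1 | h1
  · rw [Polynomial.C_eq_zero] at h1
    simp [hQ'] at h1
  · obtain ⟨a, -, ha⟩ := Multiset.mem_map.mp h1
    exact Polynomial.X_add_C_ne_zero _ ha

lemma card_zeros_le {n : ℕ} {f : MvPolynomial (Fin n) ℤ} (hf : f ≠ 0) :
    ∃ C : ℕ, ∀ p : ℕ, p.Prime →
      p * Nat.card {Q : Fin n → ZMod p // aeval Q f = 0} ≤ C * p ^ n := by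
  obtain ⟨m, hm⟩ := MvPolynomial.ne_zero_iff.mp hf
  refine ⟨f.totalDegree + (f.coeff m).natAbs, fun p hp => ?_⟩
  have : Fact p.Prime := ⟨hp⟩
  classical
  by_cases h0 : MvPolynomial.map (Int.castRingHom (ZMod p)) f = 0
  · have h1 : ((f.coeff m : ℤ) : ZMod p) = 0 := by
      simpa [MvPolynomial.coeff_map] using congrArg (MvPolynomial.coeff m) h0
    rw [ZMod.intCast_zmod_eq_zero_iff_dvd] at h1
    have h2 : p ≤ (f.coeff m).natAbs :=
      Nat.le_of_dvd (Int.natAbs_pos.mpr hm) (Int.natCast_dvd.mp h1)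
    have h3 : Nat.card {Q : Fin n → ZMod p // aeval Q f = 0} ≤ p ^ n := by
      refine (Finite.card_subtype_le _).trans ?_
      simp
    gcongr
    omega
  · have h1 := schwartz_zippel_totalDegree h0 (Finset.univ : Finset (ZMod p))
    have hp0 : (0 : ℚ≥0) < p := by exact_mod_cast hp.pos
    have h2 : Nat.card {Q : Fin n → ZMod p // aeval Q f = 0} =
        (Finset.filter (fun g => eval g (MvPolynomial.map (Int.castRingHom (ZMod p)) f) = 0)
          (Fintype.piFinset fun _ : Fin n => (Finset.univ : Finset (ZMod p)))).card := by
      rw [← Nat.card_eq_finsetCard]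
      exact Nat.card_congr (Equiv.subtypeEquivRight fun Q => by simp [eval_map, aeval_def])
    rw [← h2, Finset.card_univ, ZMod.card, div_le_div_iff₀ (by positivity) hp0] at h1
    have h3 : (MvPolynomial.map (Int.castRingHom (ZMod p)) f).totalDegree ≤ f.totalDegree :=
      Finset.sup_mono (support_map_subset _ _)
    have h4 : Nat.card {Q : Fin n → ZMod p // aeval Q f = 0} * p ≤
        (MvPolynomial.map (Int.castRingHom (ZMod p)) f).totalDegree * p ^ n := by
      exact_mod_cast h1
    rw [mul_comm]
    refine h4.trans ?_
    gcongr
    omega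

lemma card_zeros_hyperplane_le {n : ℕ} {f : MvPolynomial (Fin n) ℤ} (i : Fin n)
    {Q₀ : Fin n → ℤ} (h0 : Q₀ i = 0) (hf : aeval Q₀ f ≠ 0) :
    ∃ C : ℕ, ∀ p : ℕ, p.Prime →
      p ^ 2 * Nat.card {Q : Fin n → ZMod p // Q i = 0 ∧ aeval Q f = 0} ≤ C * p ^ n := by
  classical
  let g : MvPolynomial (Fin n) ℤ := aeval (Function.update X i 0) f
  have key {R : Type} [CommRing R] (Q : Fin n → R) :
      aeval Q g = aeval (Function.update Q i 0) f := by
    rw [MvPolynomial.comp_aeval_apply]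
    congr 2
    funext j
    by_cases h : j = i
    · subst h; simp
    · simp [h]
  have hg : g ≠ 0 := by
    intro h
    have := key Q₀
    have h1 : Function.update Q₀ i 0 = Q₀ := by rw [← h0, Function.update_eq_self]
    rw [h, map_zero, h1] at this
    exact hf this.symm
  obtain ⟨C, hC⟩ := card_zeros_le hg
  refine ⟨C, fun p hp => le_trans ?_ (hC p hp)⟩
  have : Fact p.Prime := ⟨hp⟩
  rw [sq, mul_assoc]
  refine Nat.mul_le_mul_left _ ?_
  let φ : ZMod p × {Q : Fin n → ZMod p // Q i = 0 ∧ aeval Q f = 0} →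
      {Q : Fin n → ZMod p // aeval Q g = 0} := fun x =>
    ⟨Function.update x.2.1 i x.1, by
      have h1 : Function.update x.2.1 i 0 = x.2.1 := by
        obtain ⟨-, Q, hQ, -⟩ := x
        exact (congrArg (Function.update Q i) hQ.symm).trans (Function.update_eq_self _ _)
      rw [key, Function.update_idem, h1, x.2.2.2]⟩
  have hφ : Function.Injective φ := by
    rintro ⟨s, Q, hQ, _⟩ ⟨s', Q', hQ', _⟩ h
    have h1 : Function.update Q i s = Function.update Q' i s' := congrArg Subtype.val h
    have h2 : s = s' := by simpa using congrFun h1 i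
    have h3 : Q = Q' := by
      funext j
      by_cases hj : j = i
      · subst hj; rw [hQ, hQ']
      · simpa [hj] using congrFun h1 j
    subst h2 h3
    rfl
  have := Nat.card_le_card_of_injective φ hφ
  rwa [Nat.card_prod, Nat.card_zmod] at this

/-- Reduction `ℤ/p²ℤ → ℤ/pℤ`. -/
def redMod (p : ℕ) : ZMod (p ^ 2) →+* ZMod p := ZMod.castHom (dvd_pow_self p two_ne_zero) (ZMod p)

section Lifting

variable {p : ℕ} [Fact p.Prime]

/-- The higher base-`p` digit of a residue modulo `p²`. -/
def highDigit (t : ZMod (p ^ 2)) : Fin p :=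
  ⟨t.val / p, Nat.div_lt_of_lt_mul (by rw [← sq]; exact t.val_lt)⟩

lemma eq_of_redMod_eq_of_highDigit_eq {s t : ZMod (p ^ 2)} (h : redMod p s = redMod p t)
    (h' : highDigit s = highDigit t) : s = t := by
  have h1 : s.val % p = t.val % p := by
    simp only [redMod, ZMod.castHom_apply, ZMod.cast_eq_val] at h
    exact (ZMod.natCast_eq_natCast_iff' _ _ _).mp h
  have h2 : s.val / p = t.val / p := congrArg Fin.val h'
  apply ZMod.val_injective
  rw [← Nat.div_add_mod s.val p, ← Nat.div_add_mod t.val p, h1, h2]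

lemma isUnit_of_redMod_ne_zero {s : ZMod (p ^ 2)} (h : redMod p s ≠ 0) : IsUnit s := by
  have hp : p.Prime := Fact.out
  rw [← ZMod.natCast_zmod_val s, ZMod.isUnit_iff_coprime]
  refine Nat.Coprime.pow_right 2 ((Nat.Prime.coprime_iff_not_dvd hp).mpr fun hd => h ?_).symm
  simpa only [redMod, ZMod.castHom_apply, ZMod.cast_eq_val] using
    (ZMod.natCast_eq_zero_iff _ _).mpr hd

lemma card_redMod_mem_le {n : ℕ} (S : (Fin n → ZMod p) → Prop) :
    Nat.card {Q : Fin n → ZMod (p ^ 2) // S fun i => redMod p (Q i)} ≤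
      Nat.card {Q : Fin n → ZMod p // S Q} * p ^ n := by
  let φ : {Q : Fin n → ZMod (p ^ 2) // S fun i => redMod p (Q i)} →
      {Q : Fin n → ZMod p // S Q} × (Fin n → Fin p) :=
    fun Q => (⟨_, Q.2⟩, fun i => highDigit (Q.1 i))
  have hφ : Function.Injective φ := by
    rintro ⟨Q, hQ⟩ ⟨Q', hQ'⟩ h
    simp only [φ, Prod.mk.injEq, Subtype.mk.injEq] at h
    exact Subtype.ext (funext fun i =>
      eq_of_redMod_eq_of_highDigit_eq (congrFun h.1 i) (congrFun h.2 i))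
  simpa [Nat.card_prod] using Nat.card_le_card_of_injective φ hφ

lemma card_roots_subtype_le {K : Type*} [Field K] {g : Polynomial K} (hg : g ≠ 0) :
    Nat.card {t : K // g.eval t = 0} ≤ g.natDegree := by
  classical
  have h : Nat.card {t : K // g.eval t = 0} = g.roots.toFinset.card := by
    rw [← Nat.card_eq_finsetCard]
    exact Nat.card_congr (Equiv.subtypeEquivRight fun t => by simp [hg])
  rw [h]
  exact (Multiset.toFinset_card_le _).trans (Polynomial.card_roots' g)

lemma eval_map_redMod (g : Polynomial (ZMod (p ^ 2))) (t : ZMod (p ^ 2)) :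
    (g.map (redMod p)).eval (redMod p t) = redMod p (g.eval t) := by
  rw [Polynomial.eval_map, Polynomial.eval₂_at_apply]

lemma card_roots_le_mul {g : Polynomial (ZMod (p ^ 2))} (hg : g.map (redMod p) ≠ 0) :
    Nat.card {t // g.eval t = 0} ≤ (g.map (redMod p)).natDegree * p := by
  let φ : {t // g.eval t = 0} → {t // (g.map (redMod p)).eval t = 0} × Fin p :=
    fun t => (⟨redMod p t.1, by rw [eval_map_redMod, t.2, map_zero]⟩, highDigit t.1)
  have hφ : Function.Injective φ := by
    rintro ⟨s, hs⟩ ⟨t, ht⟩ h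
    simp only [φ, Prod.mk.injEq, Subtype.mk.injEq] at h
    exact Subtype.ext (eq_of_redMod_eq_of_highDigit_eq h.1 h.2)
  have := Nat.card_le_card_of_injective φ hφ
  rw [Nat.card_prod, Nat.card_fin] at this
  exact this.trans (Nat.mul_le_mul_right _ (card_roots_subtype_le hg))

lemma card_roots_le_of_simple {g : Polynomial (ZMod (p ^ 2))} (hg : g.map (redMod p) ≠ 0)
    (hs : ∀ t, (g.map (redMod p)).eval t = 0 → (g.map (redMod p)).derivative.eval t ≠ 0) :
    Nat.card {t // g.eval t = 0} ≤ (g.map (redMod p)).natDegree := by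
  let φ : {t // g.eval t = 0} → {t // (g.map (redMod p)).eval t = 0} :=
    fun t => ⟨redMod p t.1, by rw [eval_map_redMod, t.2, map_zero]⟩
  have hφ : Function.Injective φ := by
    rintro ⟨s, hs0⟩ ⟨t, ht0⟩ h
    simp only [φ, Subtype.mk.injEq] at h
    obtain ⟨k, hk⟩ := Polynomial.binomExpansion g s (t - s)
    have h1 : (t - s) * (g.derivative.eval s + k * (t - s)) = 0 := by
      rw [add_sub_cancel, hs0, ht0] at hk
      linear_combination -hk
    have h2 : IsUnit (g.derivative.eval s + k * (t - s)) := by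
      apply isUnit_of_redMod_ne_zero
      rw [map_add, map_mul, map_sub, h, sub_self, mul_zero, add_zero, ← eval_map_redMod,
        ← Polynomial.derivative_map]
      exact hs _ (by rw [eval_map_redMod, hs0, map_zero])
    exact Subtype.ext (sub_eq_zero.mp ((h2.mul_left_eq_zero).mp h1)).symm
  exact (Nat.card_le_card_of_injective φ hφ).trans (card_roots_subtype_le hg)

end Lifting

/-- The discriminant-type resultant of the generic line polynomial and its derivative. -/
def lineDisc (d : ℕ) : MvPolynomial (Fin (2 * d + 2)) ℤ :=
  (linePoly d X).resultant (linePoly d X).derivative d (d - 1)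

lemma exists_coprime_linePoly {d : ℕ} (hd : 1 ≤ d) :
    ∃ Q : Fin (2 * d + 2) → ℚ, Q (leadIdx d) ≠ 0 ∧
      IsCoprime (linePoly d Q) (linePoly d Q).derivative := by
  let F : Polynomial ℚ := ∏ i ∈ Finset.range d, (Polynomial.X - Polynomial.C (i : ℚ))
  have hFm : F.Monic := Polynomial.monic_prod_of_monic _ _ fun i _ => Polynomial.monic_X_sub_C _
  have hFd : F.natDegree = d := by
    rw [Polynomial.natDegree_prod_of_monic _ _ fun i _ => Polynomial.monic_X_sub_C _]
    simp only [Polynomial.natDegree_X_sub_C]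
    simp
  let Q : Fin (2 * d + 2) → ℚ := fun k =>
    if (k : ℕ) ≤ d then F.coeff k else if (k : ℕ) = d + 2 then 1 else 0
  have hl : leftForm d Q = F := by
    ext m
    rw [leftForm_coeff]
    split_ifs with h
    · simp [Q, h]
    · exact (Polynomial.coeff_eq_zero_of_natDegree_lt (by omega)).symm
  have hr : rightForm d Q = Polynomial.X := by
    ext m
    rw [rightForm_coeff, Polynomial.coeff_X]
    split_ifs with h h1 h1
    · subst h1
      simp [Q]
    · simp only [Q]
      rw [if_neg (by omega), if_neg (by omega)]
    · omega
    · rfl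
  have hQ : Q (leadIdx d) = 1 := by
    have : F.coeff d = 1 := by
      simpa [Polynomial.Monic, Polynomial.leadingCoeff, hFd] using hFm
    simp [Q, leadIdx, this]
  have hs : F.Splits := Polynomial.Splits.prod fun i _ => Polynomial.Splits.X_sub_C _
  refine ⟨Q, by simp [hQ], ?_⟩
  have hroots : F.roots = (Finset.range d).val.map fun i : ℕ => (i : ℚ) := by
    have := Polynomial.roots_multiset_prod_X_sub_C ((Finset.range d).val.map fun i : ℕ => (i : ℚ))
    rwa [Multiset.map_map] at this
  rw [← Polynomial.separable_def, linePoly_eq_prod Q (by simp [hQ]) (by rwa [hl]), hl, hr, hQ,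
    hroots, Multiset.map_map]
  refine Polynomial.Separable.unit_mul (Polynomial.isUnit_C.mpr (IsUnit.mk0 _ (by simp))) ?_
  have h : (∏ i ∈ Finset.range d, (Polynomial.X - Polynomial.C (-(i : ℚ)))).Separable :=
    Polynomial.separable_prod_X_sub_C_iff'.mpr fun x _ y _ hxy => by simpa using hxy
  convert h using 1
  simp [Finset.prod]

lemma lineDisc_ne_zero {d : ℕ} (hd : 1 ≤ d) : lineDisc d ≠ 0 := by
  obtain ⟨Q, hQ, hc⟩ := exists_coprime_linePoly hd
  have hdeg := natDegree_linePoly d Q hQ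
  intro h
  let φ : MvPolynomial (Fin (2 * d + 2)) ℤ →+* ℚ := (aeval Q : _ →ₐ[ℤ] ℚ).toRingHom
  have h1 := Polynomial.resultant_map_map (linePoly d X) (linePoly d X).derivative d (d - 1) φ
  have h2 : (linePoly d X).map φ = linePoly d Q := by
    rw [linePoly_map]; simp [φ]
  rw [← lineDisc, h, map_zero, ← Polynomial.derivative_map, h2] at h1
  have h3 : (linePoly d Q).derivative.natDegree = d - 1 := by
    rw [Polynomial.natDegree_derivative, hdeg]
  refine Polynomial.resultant_ne_zero _ _ hc ?_
  rw [h3, hdeg, h1]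

lemma simple_roots_of_lineDisc_ne_zero {d : ℕ} (hd : 1 ≤ d) {K : Type*} [Field K]
    {Q : Fin (2 * d + 2) → K} (hQ : aeval Q (lineDisc d) ≠ 0) (t : K)
    (ht : (linePoly d Q).eval t = 0) : (linePoly d Q).derivative.eval t ≠ 0 := by
  intro ht'
  have hdeg : (linePoly d (X : Fin (2 * d + 2) → MvPolynomial _ ℤ)).natDegree = d :=
    natDegree_linePoly d _ (X_ne_zero _)
  obtain ⟨u, v, -, -, h⟩ := Polynomial.exists_mul_add_mul_eq_C_resultant (m := d) (n := d - 1)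
    (linePoly d (X : Fin (2 * d + 2) → MvPolynomial _ ℤ)) (linePoly d X).derivative hdeg.le
    ((Polynomial.natDegree_derivative_le _).trans (by rw [hdeg])) (by omega)
  let φ : MvPolynomial (Fin (2 * d + 2)) ℤ →+* K := (aeval Q : _ →ₐ[ℤ] K).toRingHom
  have h2 : (linePoly d X).map φ = linePoly d Q := by
    rw [linePoly_map]; simp [φ]
  have h3 := congrArg (fun f => (f.map φ).eval t) h
  simp only [Polynomial.map_add, Polynomial.map_mul, ← Polynomial.derivative_map, h2,
    Polynomial.eval_add, Polynomial.eval_mul, ht, ht', zero_mul, add_zero, Polynomial.map_C,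
    Polynomial.eval_C] at h3
  exact hQ h3.symm

lemma natDegree_linePoly_le (d : ℕ) {R : Type*} [CommRing R] (Q : Fin (2 * d + 2) → R) :
    (linePoly d Q).natDegree ≤ d := by
  let φ : MvPolynomial (Fin (2 * d + 2)) ℤ →+* R := (aeval Q : _ →ₐ[ℤ] R).toRingHom
  have h2 : (linePoly d X).map φ = linePoly d Q := by
    rw [linePoly_map]; simp [φ]
  rw [← h2]
  exact Polynomial.natDegree_map_le.trans (natDegree_linePoly d _ (X_ne_zero _)).le

lemma card_linePoly_eq_zero_le {d : ℕ} (hd : 1 ≤ d) :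
    ∃ C : ℕ, ∀ p : ℕ, p.Prime →
      p ^ 2 * Nat.card {Q : Fin (2 * d + 2) → ZMod p // linePoly d Q = 0} ≤
        C * p ^ (2 * d + 2) := by
  let Q₀ : Fin (2 * d + 2) → ℤ := fun k => if (k : ℕ) = 0 ∨ (k : ℕ) = 2 * d + 1 then 1 else 0
  have hQ₀ : Q₀ (leadIdx d) = 0 := if_neg (by simp only [leadIdx]; omega)
  have hl : leftForm d Q₀ = 1 := by
    ext m
    rw [leftForm_coeff, Polynomial.coeff_one]
    simp only [Q₀]
    split_ifs <;> first | rfl | omega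
  have hr : rightForm d Q₀ = Polynomial.X ^ d := by
    ext m
    rw [rightForm_coeff, Polynomial.coeff_X_pow]
    simp only [Q₀]
    split_ifs <;> first | rfl | omega
  have hf : aeval Q₀ (resPoly d) ≠ 0 := by
    change resEval d Q₀ ≠ 0
    rw [resEval_eq_resultant, hl, hr, Polynomial.resultant_one_right]
    simp
  obtain ⟨C, hC⟩ := card_zeros_hyperplane_le (leadIdx d) hQ₀ hf
  refine ⟨C, fun p hp => le_trans (Nat.mul_le_mul_left _ ?_) (hC p hp)⟩
  have : Fact p.Prime := ⟨hp⟩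
  refine Nat.card_le_card_of_injective (Subtype.map id fun Q hQ => ?_)
    (Subtype.map_injective _ Function.injective_id)
  refine ⟨by_contra fun h => linePoly_ne_zero d Q h hQ, ?_⟩
  have h := linePoly_eval d Q 0
  simp only [hQ, Polynomial.eval_zero, ite_self, add_zero] at h
  exact h.symm

lemma card_roots_linePoly_le {d p : ℕ} (hd : 1 ≤ d) [Fact p.Prime]
    (Q : Fin (2 * d + 2) → ZMod (p ^ 2)) [Decidable (linePoly d (fun i => redMod p (Q i)) = 0)]
    [Decidable (aeval (fun i => redMod p (Q i)) (lineDisc d) = 0)] :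
    Nat.card {t // (linePoly d Q).eval t = 0} ≤
      d + (if aeval (fun i => redMod p (Q i)) (lineDisc d) = 0 then d * p else 0) +
        if linePoly d (fun i => redMod p (Q i)) = 0 then p ^ 2 else 0 := by
  have hdeg := natDegree_linePoly_le d fun i => redMod p (Q i)
  by_cases h1 : linePoly d (fun i => redMod p (Q i)) = 0
  · rw [if_pos h1]
    refine le_trans ?_ (Nat.le_add_left _ _)
    refine (Finite.card_subtype_le _).trans ?_
    simp
  have h1' : (linePoly d Q).map (redMod p) ≠ 0 := by rwa [linePoly_map]
  by_cases h2 : aeval (fun i => redMod p (Q i)) (lineDisc d) = 0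
  · have h := card_roots_le_mul h1'
    rw [linePoly_map] at h
    have := h.trans (Nat.mul_le_mul_right p hdeg)
    rw [if_pos h2]
    omega
  · have h := card_roots_le_of_simple h1' (by
      rw [linePoly_map]
      exact simple_roots_of_lineDisc_ne_zero hd h2)
    rw [linePoly_map] at h
    omega

lemma sq_mul_card_resEval_eq_zero_le (d p : ℕ) [Fact p.Prime] :
    p ^ 2 * Nat.card {Q : Fin (2 * d + 2) → ZMod (p ^ 2) // resEval d Q = 0} ≤
      ∑ Q : Fin (2 * d + 2) → ZMod (p ^ 2), Nat.card {t // (linePoly d Q).eval t = 0} := by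
  let e : ZMod (p ^ 2) → Fin (2 * d + 2) → ZMod (p ^ 2) :=
    fun t i => if i = constIdx d then t else 0
  let φ : ZMod (p ^ 2) × {Q : Fin (2 * d + 2) → ZMod (p ^ 2) // resEval d Q = 0} →
      Σ Q : Fin (2 * d + 2) → ZMod (p ^ 2), {t // (linePoly d Q).eval t = 0} :=
    fun x => ⟨x.2.1 - e x.1, x.1, by simpa [linePoly_eval, e] using x.2.2⟩
  have hφ : Function.Injective φ := by
    rintro ⟨s, Q, hQ⟩ ⟨t, Q', hQ'⟩ h
    have h1 : Q - e s = Q' - e t := congrArg Sigma.fst h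
    have h2 : s = t := congrArg (fun y => (y.2 : ZMod (p ^ 2))) h
    subst h2
    have h3 : Q = Q' := sub_left_injective h1
    subst h3
    rfl
  have := Nat.card_le_card_of_injective φ hφ
  rwa [Nat.card_prod, Nat.card_zmod, Nat.card_sigma] at this

lemma sum_ite_const_eq_card_mul {α : Type*} [Fintype α] (S : α → Prop) [DecidablePred S] (c : ℕ) :
    (∑ a, if S a then c else 0) = Nat.card {a // S a} * c := by
  rw [← Finset.sum_filter, Finset.sum_const, Nat.card_eq_fintype_card, Fintype.card_subtype,
    smul_eq_mul]

/-- the number of zeros of `𝔯` over `ℤ/p²ℤ` is at most `C·p^{4d+2}`. -/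
theorem stmt_9 (d : ℕ) (hd : 2 ≤ d) :
    ∃ C : ℝ, 0 < C ∧ ∀ p : ℕ, p.Prime →
      (Nat.card {Q : Fin (2 * d + 2) → ZMod (p ^ 2) // resEval d Q = 0} : ℝ) ≤
        C * (p : ℝ) ^ (4 * d + 2) := by
  have hd1 : 1 ≤ d := by omega
  obtain ⟨C₁, hC₁⟩ := card_zeros_le (lineDisc_ne_zero hd1)
  obtain ⟨C₂, hC₂⟩ := card_linePoly_eq_zero_le hd1
  refine ⟨d + d * C₁ + C₂, by positivity, fun p hp => ?_⟩
  have : Fact p.Prime := ⟨hp⟩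
  classical
  set n := 2 * d + 2 with hn
  set N := Nat.card {Q : Fin n → ZMod (p ^ 2) // resEval d Q = 0}
  have h1 : p ^ 2 * N ≤ (d + d * C₁ + C₂) * (p ^ n * p ^ n) := by
    refine (sq_mul_card_resEval_eq_zero_le d p).trans ?_
    refine (Finset.sum_le_sum fun Q _ => card_roots_linePoly_le hd1 Q).trans ?_
    rw [Finset.sum_add_distrib, Finset.sum_add_distrib, sum_ite_const_eq_card_mul,
      sum_ite_const_eq_card_mul]
    have h2 := card_redMod_mem_le (p := p) fun Q : Fin n → ZMod p => aeval Q (lineDisc d) = 0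
    have h3 := card_redMod_mem_le (p := p) fun Q : Fin n → ZMod p => linePoly d Q = 0
    have h4 := hC₁ p hp
    have h5 := hC₂ p hp
    have h6 : (∑ _Q : Fin n → ZMod (p ^ 2), d) = d * (p ^ n * p ^ n) := by
      simp [mul_comm, ← pow_add, ← pow_mul, two_mul]
    rw [h6, add_mul, add_mul]
    refine add_le_add (add_le_add le_rfl ?_) ?_
    · calc _ ≤ (_ * p ^ n) * (d * p) := Nat.mul_le_mul_right _ h2
        _ = d * p ^ n * (p * _) := by ring
        _ ≤ d * p ^ n * _ := Nat.mul_le_mul_left _ h4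
        _ = _ := by ring
    · calc _ ≤ (_ * p ^ n) * p ^ 2 := Nat.mul_le_mul_right _ h3
        _ = p ^ n * (p ^ 2 * _) := by ring
        _ ≤ p ^ n * _ := Nat.mul_le_mul_left _ h5
        _ = _ := by ring
  have h2 : N ≤ (d + d * C₁ + C₂) * p ^ (4 * d + 2) := by
    refine Nat.le_of_mul_le_mul_left (h1.trans_eq ?_) (pow_pos hp.pos 2)
    rw [hn]
    ring
  exact_mod_cast h2
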